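/- Let m ≥ 1, α⃗ ∈ {0,1}^m with σ(α⃗) ≤ 1, and 1 < p₁,…,p_m, r < ∞ with Σ_{j=1}^m 1/p_j = 1/r, and let b be locally integrable. If there is a constant C such that ‖π_b^{α⃗}(f₁,…,f_m)‖_{L^r} ≤ C ∏_{j=1}^m ‖f_j‖_{L^{p_j}} for all bounded compactly supported f₁,…,f_m, then b ∈ BMO^d, and ‖b‖_{BMO^d} ≤ C'·C for a constant C' depending only on m, p₁,…,p_m, r. -/

import Mathlib

open MeasureTheory Filter Topology
open scoped ENNReal NNReal Classical

noncomputable section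

/-- The dyadic interval `[n·2⁻ᵏ, (n+1)·2⁻ᵏ)`. -/
def dyadicI (n k : ℤ) : Set ℝ :=
  Set.Ico ((n : ℝ) * (2 : ℝ) ^ (-k)) (((n : ℝ) + 1) * (2 : ℝ) ^ (-k))

/-- The Haar function `h_I = |I|^{-1/2} (1_{I₊} - 1_{I₋})` of the dyadic interval
`I = [n·2⁻ᵏ, (n+1)·2⁻ᵏ)`, whose halves are the dyadic intervals indexed by
`(2n, k+1)` and `(2n+1, k+1)`. -/
def haarF (n k : ℤ) : ℝ → ℝ := fun x =>
  (Real.sqrt ((2 : ℝ) ^ (-k)))⁻¹ *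
    ((dyadicI (2 * n + 1) (k + 1)).indicator (fun _ => (1 : ℝ)) x -
      (dyadicI (2 * n) (k + 1)).indicator (fun _ => (1 : ℝ)) x)

/-- `⟨f, h_I⟩ = ∫ f h_I`. -/
def pairH (f : ℝ → ℝ) (n k : ℤ) : ℝ := ∫ x, f x * haarF n k x

/-- `⟨f⟩_I = |I|⁻¹ ∫_I f`. -/
def avgI (f : ℝ → ℝ) (n k : ℤ) : ℝ := (2 : ℝ) ^ k * ∫ x in dyadicI n k, f x

/-- `f(I, α)` for `α ∈ {0,1}`, where `false` is `0` (Haar coefficient)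
and `true` is `1` (average). -/
def coefI (f : ℝ → ℝ) (a : Bool) (n k : ℤ) : ℝ := if a then avgI f n k else pairH f n k

/-- `σ(α⃗)`, the number of `0` components of `α⃗ ∈ {0,1}^m`. -/
def sigmaV {m : ℕ} (α : Fin m → Bool) : ℕ := (Finset.univ.filter fun j => α j = false).card

/-- The term `P_I^{α⃗}(f₁,…,f_m)(x) = (∏ f_j(I,α_j)) h_I^{σ(α⃗)}(x)` for `I = (n,k)`. -/
def Pterm {m : ℕ} (α : Fin m → Bool) (f : Fin m → ℝ → ℝ) (n k : ℤ) (x : ℝ) : ℝ :=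
  (∏ j, coefI (f j) (α j) n k) * haarF n k x ^ sigmaV α

/-- The term of the paraproduct `π_b^{α⃗}`:
`⟨b, h_I⟩ (∏ f_j(I,α_j)) h_I^{1+σ(α⃗)}(x)` for `I = (n,k)`. -/
def piTerm {m : ℕ} (b : ℝ → ℝ) (α : Fin m → Bool) (f : Fin m → ℝ → ℝ) (n k : ℤ) (x : ℝ) : ℝ :=
  pairH b n k * (∏ j, coefI (f j) (α j) n k) * haarF n k x ^ (1 + sigmaV α)

/-- The term of the `m`-linear Haar multiplier `T_ε^{α⃗}`:
`ε_I (∏ f_j(I,α_j)) h_I^{σ(α⃗)}(x)` for `I = (n,k)`. -/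
def Tterm {m : ℕ} (ε : ℤ → ℤ → ℝ) (α : Fin m → Bool) (f : Fin m → ℝ → ℝ) (n k : ℤ) (x : ℝ) : ℝ :=
  ε n k * (∏ j, coefI (f j) (α j) n k) * haarF n k x ^ sigmaV α

/-- Partial sum of a series indexed by the dyadic grid: all scales `k` with `|k| ≤ N`
(at each scale the sum over positions is a `tsum`). -/
def dyadicPartialSum (F : ℤ → ℤ → ℝ → ℝ) (N : ℕ) (x : ℝ) : ℝ :=
  ∑ k ∈ Finset.Icc (-(N : ℤ)) (N : ℤ), ∑' n : ℤ, F n k x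

/-- `g` is the a.e.-pointwise sum of the series `Σ_{I ∈ 𝒟} F_I`. -/
def HasDyadicSum (F : ℤ → ℤ → ℝ → ℝ) (g : ℝ → ℝ) : Prop :=
  ∀ᵐ x : ℝ ∂volume, Tendsto (fun N => dyadicPartialSum F N x) atTop (𝓝 (g x))

/-- The dyadic BMO norm `sup_{I∈𝒟} |I|⁻¹ ∫_I |b - ⟨b⟩_I|`. -/
def bmoNorm (b : ℝ → ℝ) : ℝ≥0∞ :=
  ⨆ (n : ℤ) (k : ℤ),
    ENNReal.ofReal ((2 : ℝ) ^ k) * ∫⁻ x in dyadicI n k, ENNReal.ofReal |b x - avgI b n k|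

/-- The weak `L^r` quasinorm `sup_{t>0} t |{|f| > t}|^{1/r}`. -/
def wnorm' (r : ℝ) (f : ℝ → ℝ) : ℝ≥0∞ :=
  ⨆ t : ℝ≥0, (t : ℝ≥0∞) * volume {x : ℝ | (t : ℝ) < |f x|} ^ (1 / r)

/-- `sup_{I∈𝒟} |⟨b,h_I⟩| / √|I|`. -/
def starNorm (b : ℝ → ℝ) : ℝ≥0∞ :=
  ⨆ (n : ℤ) (k : ℤ), ENNReal.ofReal (|pairH b n k| / Real.sqrt ((2 : ℝ) ^ (-k)))

/-- Bounded, compactly supported, measurable function. -/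
def BCS (f : ℝ → ℝ) : Prop :=
  Measurable f ∧ (∃ M : ℝ, ∀ x, |f x| ≤ M) ∧ HasCompactSupport f

/-- `‖ε‖_∞ = sup_{I∈𝒟} |ε_I|` for a symbol sequence indexed by the dyadic grid. -/
def epsNorm (ε : ℤ → ℤ → ℝ) : ℝ≥0∞ := ⨆ (n : ℤ) (k : ℤ), ENNReal.ofReal |ε n k|

lemma mem_dyadicI_iff {n k : ℤ} {x : ℝ} : x ∈ dyadicI n k ↔ ⌊x * (2 : ℝ) ^ k⌋ = n := by
  have h : (0 : ℝ) < (2 : ℝ) ^ k := by positivity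
  rw [Int.floor_eq_iff, dyadicI, Set.mem_Ico, zpow_neg, ← div_eq_mul_inv, ← div_eq_mul_inv,
    div_le_iff₀ h, lt_div_iff₀ h]

lemma measurableSet_dyadicI (n k : ℤ) : MeasurableSet (dyadicI n k) := measurableSet_Ico

lemma volume_dyadicI (n k : ℤ) : volume (dyadicI n k) = ENNReal.ofReal ((2 : ℝ) ^ (-k)) := by
  rw [dyadicI, Real.volume_Ico]
  congr 1
  ring

lemma volume_real_dyadicI (n k : ℤ) : volume.real (dyadicI n k) = (2 : ℝ) ^ (-k) := by
  rw [measureReal_def, volume_dyadicI, ENNReal.toReal_ofReal (by positivity)]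

lemma volume_dyadicI_ne_top (n k : ℤ) : volume (dyadicI n k) ≠ ∞ := by
  simp [volume_dyadicI]

lemma floor_mul_two_zpow_eq_ediv (x : ℝ) (k : ℤ) :
    ⌊x * (2 : ℝ) ^ k⌋ = ⌊x * (2 : ℝ) ^ (k + 1)⌋ / 2 := by
  have h : x * (2 : ℝ) ^ k = x * (2 : ℝ) ^ (k + 1) / (2 : ℕ) := by
    rw [zpow_add_one₀ two_ne_zero]
    push_cast
    ring
  rw [h, Int.floor_div_natCast]
  rfl

lemma dyadicI_eq_union (n k : ℤ) :
    dyadicI n k = dyadicI (2 * n) (k + 1) ∪ dyadicI (2 * n + 1) (k + 1) := by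
  ext x
  simp only [Set.mem_union, mem_dyadicI_iff, floor_mul_two_zpow_eq_ediv x k]
  omega

lemma disjoint_dyadicI_halves (n k : ℤ) :
    Disjoint (dyadicI (2 * n) (k + 1)) (dyadicI (2 * n + 1) (k + 1)) := by
  rw [Set.disjoint_left]
  intro x hx hx'
  rw [mem_dyadicI_iff] at hx hx'
  omega

lemma left_half_subset (n k : ℤ) : dyadicI (2 * n) (k + 1) ⊆ dyadicI n k := by
  rw [dyadicI_eq_union n k]
  exact Set.subset_union_left

lemma right_half_subset (n k : ℤ) : dyadicI (2 * n + 1) (k + 1) ⊆ dyadicI n k := by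
  rw [dyadicI_eq_union n k]
  exact Set.subset_union_right

lemma setIntegral_dyadicI_eq_add {u : ℝ → ℝ} {n k : ℤ} (hu : IntegrableOn u (dyadicI n k)) :
    ∫ x in dyadicI n k, u x =
      (∫ x in dyadicI (2 * n) (k + 1), u x) + ∫ x in dyadicI (2 * n + 1) (k + 1), u x := by
  rw [dyadicI_eq_union n k]
  exact setIntegral_union (disjoint_dyadicI_halves n k) (measurableSet_dyadicI _ _)
    (hu.mono_set (left_half_subset n k)) (hu.mono_set (right_half_subset n k))

lemma integrableOn_dyadicI {u : ℝ → ℝ} (hu : LocallyIntegrable u volume) (n k : ℤ) :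
    IntegrableOn u (dyadicI n k) :=
  (hu.integrableOn_isCompact isCompact_Icc).mono_set Set.Ico_subset_Icc_self

lemma avgI_eq_half_add {u : ℝ → ℝ} (hu : LocallyIntegrable u volume) (n k : ℤ) :
    avgI u n k = (avgI u (2 * n) (k + 1) + avgI u (2 * n + 1) (k + 1)) / 2 := by
  simp only [avgI]
  rw [setIntegral_dyadicI_eq_add (integrableOn_dyadicI hu n k), zpow_add_one₀ two_ne_zero]
  ring

lemma avgI_eq_of_eqOn {u : ℝ → ℝ} {n k : ℤ} {c : ℝ} (h : ∀ x ∈ dyadicI n k, u x = c) :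
    avgI u n k = c := by
  rw [avgI, setIntegral_congr_fun (measurableSet_dyadicI n k) h, setIntegral_const,
    volume_real_dyadicI, smul_eq_mul, ← mul_assoc, ← zpow_add₀ two_ne_zero]
  simp

/-- If all averages over intervals of one scale vanish, so do those at all coarser scales. -/
lemma avgI_eq_zero_of_le {u : ℝ → ℝ} (hu : LocallyIntegrable u volume) {k : ℤ}
    (h : ∀ n, avgI u n k = 0) {l : ℤ} (hl : l ≤ k) (n : ℤ) : avgI u n l = 0 := by
  induction l, hl using Int.leInductionDown generalizing n with
  | base => exact h n
  | pred l _ ih =>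
    rw [avgI_eq_half_add hu, sub_add_cancel, ih, ih]
    simp

/-- The average of `u` over the dyadic interval of length `2⁻ᵏ` containing `x`. -/
def dyadicExp (u : ℝ → ℝ) (k : ℤ) (x : ℝ) : ℝ := avgI u ⌊x * (2 : ℝ) ^ k⌋ k

lemma dyadicExp_eq {u : ℝ → ℝ} {n k : ℤ} {x : ℝ} (hx : x ∈ dyadicI n k) :
    dyadicExp u k x = avgI u n k := by
  rw [dyadicExp, mem_dyadicI_iff.1 hx]

lemma pairH_eq {u : ℝ → ℝ} (hu : LocallyIntegrable u volume) (n k : ℤ) :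
    pairH u n k = (Real.sqrt ((2 : ℝ) ^ (-k)))⁻¹ *
      ((∫ x in dyadicI (2 * n + 1) (k + 1), u x) - ∫ x in dyadicI (2 * n) (k + 1), u x) := by
  have h : ∀ x, u x * haarF n k x = (Real.sqrt ((2 : ℝ) ^ (-k)))⁻¹ *
      ((dyadicI (2 * n + 1) (k + 1)).indicator u x - (dyadicI (2 * n) (k + 1)).indicator u x) := by
    intro x
    simp only [haarF, Set.indicator_apply]
    split_ifs <;> ring
  simp only [pairH, h]
  rw [integral_const_mul, integral_sub, integral_indicator (measurableSet_dyadicI _ _),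
    integral_indicator (measurableSet_dyadicI _ _)]
  · exact (integrableOn_dyadicI hu _ _).integrable_indicator (measurableSet_dyadicI _ _)
  · exact (integrableOn_dyadicI hu _ _).integrable_indicator (measurableSet_dyadicI _ _)

lemma pairH_mul_haarF {u : ℝ → ℝ} (hu : LocallyIntegrable u volume) {n k : ℤ} {x : ℝ}
    (hx : x ∈ dyadicI n k) :
    pairH u n k * haarF n k x = dyadicExp u (k + 1) x - dyadicExp u k x := by
  have hc : (Real.sqrt ((2 : ℝ) ^ (-k)))⁻¹ * (Real.sqrt ((2 : ℝ) ^ (-k)))⁻¹ = (2 : ℝ) ^ k := by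
    rw [← mul_inv, Real.mul_self_sqrt (by positivity), zpow_neg, inv_inv]
  have hdis := Set.disjoint_left.1 (disjoint_dyadicI_halves n k)
  rw [pairH_eq hu, haarF, dyadicExp_eq hx, avgI_eq_half_add hu]
  rw [dyadicI_eq_union] at hx
  rcases hx with h | h
  · rw [Set.indicator_of_mem h, Set.indicator_of_notMem (hdis h), dyadicExp_eq h]
    simp only [avgI]
    rw [zpow_add_one₀ two_ne_zero, ← hc]
    ring
  · rw [Set.indicator_of_mem h, Set.indicator_of_notMem (fun h' => hdis h' h), dyadicExp_eq h]
    simp only [avgI]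
    rw [zpow_add_one₀ two_ne_zero, ← hc]
    ring

lemma haarF_eq_zero {n k : ℤ} {x : ℝ} (hx : x ∉ dyadicI n k) : haarF n k x = 0 := by
  rw [haarF, Set.indicator_of_notMem (fun h => hx (right_half_subset n k h)),
    Set.indicator_of_notMem (fun h => hx (left_half_subset n k h))]
  simp

lemma dyadicPartialSum_piTerm {m : ℕ} (b : ℝ → ℝ) (α : Fin m → Bool) (f : Fin m → ℝ → ℝ)
    (N : ℕ) (x : ℝ) :
    dyadicPartialSum (piTerm b α f) N x =
      ∑ k ∈ Finset.Icc (-(N : ℤ)) N, piTerm b α f ⌊x * (2 : ℝ) ^ k⌋ k x := by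
  refine Finset.sum_congr rfl fun k _ => tsum_eq_single _ fun n hn => ?_
  rw [piTerm, haarF_eq_zero (fun h => hn (mem_dyadicI_iff.1 h).symm)]
  simp

/-- Dyadic Lebesgue differentiation. -/
lemma ae_tendsto_dyadicExp {u : ℝ → ℝ} (hu : LocallyIntegrable u volume) :
    ∀ᵐ x, Tendsto (fun k : ℤ => dyadicExp u k x) atTop (𝓝 (u x)) := by
  filter_upwards [IsUnifLocDoublingMeasure.ae_tendsto_average volume hu 1] with x hx
  have hδ : Tendsto (fun k : ℤ => (2 : ℝ) ^ (-k) / 2) atTop (𝓝[>] 0) := by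
    refine tendsto_nhdsWithin_iff.2 ⟨?_, Eventually.of_forall fun k => ?_⟩
    · have h : Tendsto (fun k : ℤ => (2 : ℝ) ^ (-k)) atTop (𝓝 0) := by
        have hle : ∀ k : ℤ, (k : ℝ) ≤ (2 : ℝ) ^ k := by
          intro k
          rcases le_total k 0 with hk | hk
          · exact (Int.cast_nonpos.2 hk).trans (by positivity)
          · lift k to ℕ using hk
            exact_mod_cast Nat.lt_two_pow_self.le
        simp only [zpow_neg]
        exact (tendsto_atTop_mono hle tendsto_intCast_atTop_atTop).inv_tendsto_atTop
      simpa using h.div_const 2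
    · have : (0 : ℝ) < (2 : ℝ) ^ (-k) := by positivity
      simpa using this
  have key := hx (fun k : ℤ => ((⌊x * (2 : ℝ) ^ k⌋ : ℝ) + 1 / 2) * (2 : ℝ) ^ (-k)) _ hδ
    (Eventually.of_forall fun k => ?_)
  · refine key.congr fun k => ?_
    rw [Real.closedBall_eq_Icc, dyadicExp, avgI, average_eq, measureReal_restrict_apply_univ,
      integral_Icc_eq_integral_Ico, Real.volume_real_Icc_of_le (by
        have : (0 : ℝ) < (2 : ℝ) ^ (-k) := by positivity
        linarith), smul_eq_mul, dyadicI]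
    congr 1
    · ring_nf
      rw [← zpow_neg, neg_neg]
    · ring_nf
  · have h : x ∈ dyadicI ⌊x * (2 : ℝ) ^ k⌋ k := mem_dyadicI_iff.2 rfl
    rw [dyadicI, Set.mem_Ico] at h
    rw [Real.closedBall_eq_Icc, Set.mem_Icc]
    constructor <;> linarith [h.1, h.2]

/-- `g` is constant on each dyadic interval of length `2⁻ᵏ`. -/
def IsDyadicStep (k : ℤ) (g : ℝ → ℝ) : Prop :=
  ∀ x y, ⌊x * (2 : ℝ) ^ k⌋ = ⌊y * (2 : ℝ) ^ k⌋ → g x = g y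

lemma isDyadicStep_dyadicExp (u : ℝ → ℝ) (k : ℤ) : IsDyadicStep k (dyadicExp u k) := by
  intro x y h
  rw [dyadicExp, dyadicExp, h]

lemma IsDyadicStep.mono {k l : ℤ} {g : ℝ → ℝ} (hg : IsDyadicStep k g) (hkl : k ≤ l) :
    IsDyadicStep l g := by
  induction l, hkl using Int.leInduction with
  | base => exact hg
  | succ l _ ih =>
    intro x y h
    exact ih x y (by rw [floor_mul_two_zpow_eq_ediv x, floor_mul_two_zpow_eq_ediv y, h])

lemma isDyadicStep_comp (φ : ℤ → ℝ) (k : ℤ) :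
    IsDyadicStep k (fun x => φ ⌊x * (2 : ℝ) ^ k⌋) := by
  intro x y h
  simp only [h]

lemma isDyadicStep_indicator_one (n k : ℤ) :
    IsDyadicStep k ((dyadicI n k).indicator fun _ => 1) := by
  intro x y h
  simp only [Set.indicator_apply, mem_dyadicI_iff, h]

lemma isDyadicStep_indicator (n : ℤ) {k l : ℤ} (hkl : k ≤ l) {g : ℝ → ℝ}
    (hg : IsDyadicStep l g) : IsDyadicStep l ((dyadicI n k).indicator g) := by
  intro x y h
  have h1 := (isDyadicStep_indicator_one n k).mono hkl x y h
  have h2 := hg x y h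
  simp only [Set.indicator_apply] at h1 ⊢
  split_ifs at h1 ⊢ <;> simp_all

lemma IsDyadicStep.measurable {k : ℤ} {g : ℝ → ℝ} (hg : IsDyadicStep k g) : Measurable g := by
  have h : g = (fun i : ℤ => g (i * (2 : ℝ) ^ (-k))) ∘ fun x : ℝ => ⌊x * (2 : ℝ) ^ k⌋ := by
    ext x
    refine hg _ _ ?_
    rw [mul_assoc, ← zpow_add₀ two_ne_zero]
    simp
  rw [h]
  exact (measurable_of_countable _).comp (Int.measurable_floor.comp (measurable_id.mul_const _))

lemma IsDyadicStep.integrableOn {k l : ℤ} {g : ℝ → ℝ} (hg : IsDyadicStep l g) (hkl : k ≤ l)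
    (n : ℤ) : IntegrableOn g (dyadicI n k) := by
  induction k, hkl using Int.leInductionDown generalizing n with
  | base =>
    refine (integrableOn_const (volume_dyadicI_ne_top n l)
      (C := g (n * (2 : ℝ) ^ (-l)))).congr_fun (fun x hx => hg _ _ ?_) (measurableSet_dyadicI n l)
    rw [mem_dyadicI_iff.1 hx, mul_assoc, ← zpow_add₀ two_ne_zero]
    simp
  | pred k _ ih =>
    rw [dyadicI_eq_union, sub_add_cancel]
    exact (ih _).union (ih _)

lemma IsDyadicStep.dyadicExp_eq {k l : ℤ} {g : ℝ → ℝ} (hg : IsDyadicStep k g) (hkl : k ≤ l)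
    (x : ℝ) : dyadicExp g l x = g x :=
  avgI_eq_of_eqOn fun _ hy => hg.mono hkl _ _ (mem_dyadicI_iff.1 hy)

lemma dyadicExp_eq_on_half {u : ℝ → ℝ} {n k : ℤ} {x : ℝ} (hx : x ∈ dyadicI n (k + 1)) :
    dyadicExp u k x = avgI u (n / 2) k := by
  rw [dyadicExp, floor_mul_two_zpow_eq_ediv, mem_dyadicI_iff.1 hx]

lemma setIntegral_dyadicI_of_eqOn {g : ℝ → ℝ} {n k : ℤ} {c : ℝ}
    (h : ∀ x ∈ dyadicI n k, g x = c) : ∫ x in dyadicI n k, g x = (2 : ℝ) ^ (-k) * c := by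
  rw [setIntegral_congr_fun (measurableSet_dyadicI n k) h, setIntegral_const,
    volume_real_dyadicI, smul_eq_mul]

/-- The product of the martingale differences of `u` and `v` at scale `k`. -/
def diffMul (u v : ℝ → ℝ) (k : ℤ) (x : ℝ) : ℝ :=
  (dyadicExp u (k + 1) x - dyadicExp u k x) * (dyadicExp v (k + 1) x - dyadicExp v k x)

lemma isDyadicStep_diffMul (u v : ℝ → ℝ) (k : ℤ) : IsDyadicStep (k + 1) (diffMul u v k) := by
  intro x y h
  simp only [diffMul, isDyadicStep_dyadicExp u (k + 1) x y h,
    isDyadicStep_dyadicExp v (k + 1) x y h,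
    (isDyadicStep_dyadicExp u k).mono (by lia : k ≤ k + 1) x y h,
    (isDyadicStep_dyadicExp v k).mono (by lia : k ≤ k + 1) x y h]

lemma isDyadicStep_sum_diffMul (u v : ℝ → ℝ) (k l : ℤ) :
    IsDyadicStep l (fun x => ∑ i ∈ Finset.Ico k l, diffMul u v i x) := by
  intro x y h
  refine Finset.sum_congr rfl fun i hi => ?_
  exact (isDyadicStep_diffMul u v i).mono (by simp at hi; lia) x y h

lemma isDyadicStep_dyadicExp_mul (u v : ℝ → ℝ) (k : ℤ) :
    IsDyadicStep k (fun x => dyadicExp u k x * dyadicExp v k x) := by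
  intro x y h
  simp only [isDyadicStep_dyadicExp u k x y h, isDyadicStep_dyadicExp v k x y h]

lemma setIntegral_diffMul {u v : ℝ → ℝ} (hu : LocallyIntegrable u volume)
    (hv : LocallyIntegrable v volume) (n k : ℤ) :
    ∫ x in dyadicI n k, diffMul u v k x =
      (2 : ℝ) ^ (-(k + 1)) * (avgI u (2 * n) (k + 1) * avgI v (2 * n) (k + 1)) +
      (2 : ℝ) ^ (-(k + 1)) * (avgI u (2 * n + 1) (k + 1) * avgI v (2 * n + 1) (k + 1)) -
      (2 : ℝ) ^ (-k) * (avgI u n k * avgI v n k) := by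
  have hhalf : (2 : ℝ) ^ (-k) = 2 * (2 : ℝ) ^ (-(k + 1)) := by
    rw [neg_add, zpow_add₀ two_ne_zero, zpow_neg_one]
    ring
  have h : ∀ i, i / 2 = n → ∀ x ∈ dyadicI i (k + 1), diffMul u v k x =
      (avgI u i (k + 1) - avgI u n k) * (avgI v i (k + 1) - avgI v n k) := by
    intro i hi x hx
    rw [diffMul, dyadicExp_eq hx, dyadicExp_eq hx, dyadicExp_eq_on_half hx,
      dyadicExp_eq_on_half hx, hi]
  rw [setIntegral_dyadicI_eq_add ((isDyadicStep_diffMul u v k).integrableOn (by lia) n),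
    setIntegral_dyadicI_of_eqOn (h _ (by lia)), setIntegral_dyadicI_of_eqOn (h _ (by lia)),
    hhalf, avgI_eq_half_add hu n k, avgI_eq_half_add hv n k]
  ring

/-- Orthogonality of martingale differences on a dyadic interval. -/
lemma setIntegral_sum_diffMul {u v : ℝ → ℝ} (hu : LocallyIntegrable u volume)
    (hv : LocallyIntegrable v volume) (d : ℕ) (n k : ℤ) :
    ∫ x in dyadicI n k, ∑ i ∈ Finset.Ico k (k + d), diffMul u v i x =
      (∫ x in dyadicI n k, dyadicExp u (k + d) x * dyadicExp v (k + d) x) -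
        (2 : ℝ) ^ (-k) * (avgI u n k * avgI v n k) := by
  induction d generalizing n k with
  | zero =>
    rw [setIntegral_dyadicI_of_eqOn (g := fun x => dyadicExp u (k + (0 : ℕ)) x * _)
      (c := avgI u n k * avgI v n k)]
    · simp
    · intro x hx
      simp [dyadicExp_eq hx]
  | succ d ih =>
    have hk : k + ((d + 1 : ℕ) : ℤ) = k + 1 + d := by push_cast; ring
    have hsum : ∀ x, ∑ i ∈ Finset.Ico k (k + 1 + d), diffMul u v i x =
        diffMul u v k x + ∑ i ∈ Finset.Ico (k + 1) (k + 1 + d), diffMul u v i x := by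
      intro x
      have hins : Finset.Ico k (k + 1 + d) = insert k (Finset.Ico (k + 1) (k + 1 + d)) := by
        ext i
        simp only [Finset.mem_insert, Finset.mem_Ico]
        lia
      rw [hins, Finset.sum_insert (by simp)]
    rw [hk]
    simp only [hsum]
    rw [integral_add ((isDyadicStep_diffMul u v k).integrableOn (by lia) n)
      ((isDyadicStep_sum_diffMul u v _ _).integrableOn (by lia) n),
      setIntegral_dyadicI_eq_add ((isDyadicStep_sum_diffMul u v _ _).integrableOn (by lia) n),
      ih, ih, setIntegral_diffMul hu hv,
      setIntegral_dyadicI_eq_add (n := n) (k := k)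
        ((isDyadicStep_dyadicExp_mul u v _).integrableOn (by lia) n)]
    ring

lemma eLpNorm_le_of_support {f : ℝ → ℝ} {p : ℝ} (hp : 1 < p) {n k : ℤ} (hb : ∀ x, |f x| ≤ 2)
    (hs : ∀ x ∉ dyadicI n k, f x = 0) :
    eLpNorm f (ENNReal.ofReal p) volume ≤ 2 * volume (dyadicI n k) ^ (1 / p) := by
  have h : eLpNorm f (ENNReal.ofReal p) volume ≤
      eLpNorm ((dyadicI n k).indicator fun _ => (2 : ℝ)) (ENNReal.ofReal p) volume := by
    refine eLpNorm_mono_real fun x => ?_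
    by_cases hx : x ∈ dyadicI n k
    · simpa [hx] using hb x
    · simp [hx, hs x hx]
  refine h.trans ((eLpNorm_indicator_const_le _ _).trans_eq ?_)
  rw [ENNReal.toReal_ofReal (by linarith)]
  congr 1
  simp [Real.enorm_eq_ofReal]

lemma prod_eLpNorm_le {m : ℕ} {p : Fin m → ℝ} (hp : ∀ j, 1 < p j) {r : ℝ}
    (hr : ∑ j, 1 / p j = 1 / r) {f : Fin m → ℝ → ℝ} {n k : ℤ} (hb : ∀ j x, |f j x| ≤ 2)
    (hs : ∀ j, ∀ x ∉ dyadicI n k, f j x = 0) :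
    ∏ j, eLpNorm (f j) (ENNReal.ofReal (p j)) volume ≤
      2 ^ m * volume (dyadicI n k) ^ (1 / r) := by
  refine (Finset.prod_le_prod' fun j _ => eLpNorm_le_of_support (hp j) (hb j) (hs j)).trans_eq ?_
  have hv : volume (dyadicI n k) ≠ 0 := by
    rw [volume_dyadicI]
    have : (0 : ℝ) < (2 : ℝ) ^ (-k) := by positivity
    simpa using this
  have hprod : ∀ s : Finset (Fin m), ∏ j ∈ s, volume (dyadicI n k) ^ (1 / p j) =
      volume (dyadicI n k) ^ ∑ j ∈ s, 1 / p j := by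
    intro s
    induction s using Finset.induction_on with
    | empty => simp
    | insert j s hj ih =>
      rw [Finset.prod_insert hj, Finset.sum_insert hj, ih,
        ENNReal.rpow_add _ _ hv (volume_dyadicI_ne_top n k)]
  rw [Finset.prod_mul_distrib, Finset.prod_const, ← hr, hprod]
  simp

/-- Hölder's inequality on a dyadic interval, for test functions adapted to its parent. -/
lemma lintegral_le_of_eLpNorm_le {m : ℕ} {p : Fin m → ℝ} (hp : ∀ j, 1 < p j) {r : ℝ}
    (hr1 : 1 < r) (hr : ∑ j, 1 / p j = 1 / r) {f : Fin m → ℝ → ℝ} {n k : ℤ}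
    (hb : ∀ j x, |f j x| ≤ 2) (hs : ∀ j, ∀ x ∉ dyadicI (n / 2) (k - 1), f j x = 0)
    {g : ℝ → ℝ} (hg : AEStronglyMeasurable g volume) {C : ℝ}
    (h : eLpNorm' g r volume ≤
      ENNReal.ofReal C * ∏ j, eLpNorm (f j) (ENNReal.ofReal (p j)) volume) :
    ENNReal.ofReal ((2 : ℝ) ^ k) * ∫⁻ x in dyadicI n k, ENNReal.ofReal |g x| ≤
      ENNReal.ofReal (2 ^ (m + 1) * C) := by
  set v := volume (dyadicI n k) with hv
  have hr0 : 0 < r := by linarith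
  have hr2 : 1 / r ≤ 1 := by rw [div_le_one hr0]; exact hr1.le
  have hparent : volume (dyadicI (n / 2) (k - 1)) = 2 * v := by
    rw [hv, volume_dyadicI, volume_dyadicI, neg_sub, sub_eq_add_neg, zpow_add₀ two_ne_zero,
      ENNReal.ofReal_mul (by norm_num)]
    simp
  have hvk : ENNReal.ofReal ((2 : ℝ) ^ k) * v = 1 := by
    rw [hv, volume_dyadicI, ← ENNReal.ofReal_mul (by positivity), ← zpow_add₀ two_ne_zero]
    simp
  have hsplit : v ^ (1 / r) * v ^ (1 - 1 / r) = v := by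
    rw [← ENNReal.rpow_add_of_nonneg _ _ (by positivity) (by linarith)]
    simp
  have hholder : ∫⁻ x in dyadicI n k, ENNReal.ofReal |g x| ≤
      eLpNorm' g r volume * v ^ (1 - 1 / r) := by
    have h1 := eLpNorm'_le_eLpNorm'_mul_rpow_measure_univ (μ := volume.restrict (dyadicI n k))
      one_pos hr1.le hg.restrict
    have h2 := eLpNorm'_mono_measure g (Measure.restrict_le_self (μ := volume)
      (s := dyadicI n k)) hr0.le
    have h3 : ∫⁻ x in dyadicI n k, ENNReal.ofReal |g x| =
        eLpNorm' g 1 (volume.restrict (dyadicI n k)) := by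
      simp [eLpNorm'_eq_lintegral_enorm, Real.enorm_eq_ofReal_abs]
    rw [Measure.restrict_apply_univ, div_one] at h1
    rw [h3]
    exact h1.trans (by gcongr)
  have htwo : (2 : ℝ≥0∞) ^ (1 / r) ≤ 2 := by
    simpa using ENNReal.rpow_le_rpow_of_exponent_le one_le_two hr2
  calc ENNReal.ofReal ((2 : ℝ) ^ k) * ∫⁻ x in dyadicI n k, ENNReal.ofReal |g x|
      ≤ ENNReal.ofReal ((2 : ℝ) ^ k) *
        ((ENNReal.ofReal C * (2 ^ m * (2 * v ^ (1 / r)))) * v ^ (1 - 1 / r)) := by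
        gcongr
        refine hholder.trans ?_
        gcongr
        refine h.trans ?_
        gcongr
        refine (prod_eLpNorm_le hp hr hb hs).trans ?_
        rw [hparent, ENNReal.mul_rpow_of_nonneg _ _ (by positivity)]
        gcongr
    _ = ENNReal.ofReal C * 2 ^ (m + 1) * (ENNReal.ofReal ((2 : ℝ) ^ k) *
          (v ^ (1 / r) * v ^ (1 - 1 / r))) := by ring
    _ = ENNReal.ofReal (2 ^ (m + 1) * C) := by
        rw [hsplit, hvk, mul_one, ENNReal.ofReal_mul (by positivity), mul_comm,
          ENNReal.ofReal_pow (by norm_num)]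
        simp

lemma IsDyadicStep.bcs {l : ℤ} {f : ℝ → ℝ} (hf : IsDyadicStep l f) (hb : ∀ x, |f x| ≤ 2)
    {n k : ℤ} (hs : ∀ x ∉ dyadicI n k, f x = 0) : BCS f :=
  ⟨hf.measurable, ⟨2, hb⟩, HasCompactSupport.intro isCompact_Icc fun x hx =>
    hs x fun h => hx (Set.Ico_subset_Icc_self h)⟩

lemma IsDyadicStep.locallyIntegrable {l : ℤ} {f : ℝ → ℝ} (hf : IsDyadicStep l f)
    (hb : ∀ x, |f x| ≤ 2) : LocallyIntegrable f volume :=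
  (locallyIntegrable_const (2 : ℝ)).mono hf.measurable.aestronglyMeasurable
    (Eventually.of_forall fun x => by simpa using hb x)

lemma sum_Ico_int_sub (a : ℤ → ℝ) (k : ℤ) (d : ℕ) :
    ∑ l ∈ Finset.Ico k (k + d), (a (l + 1) - a l) = a (k + d) - a k := by
  induction d with
  | zero => simp
  | succ d ih =>
    have hins : Finset.Ico k (k + ((d + 1 : ℕ) : ℤ)) = insert (k + d) (Finset.Ico k (k + d)) := by
      ext i
      simp only [Finset.mem_insert, Finset.mem_Ico]
      lia
    rw [hins, Finset.sum_insert (by simp), ih]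
    push_cast
    rw [← add_assoc]
    ring

lemma dyadicPartialSum_eq_sum_Ico {m : ℕ} {b : ℝ → ℝ} {α : Fin m → Bool} {f : Fin m → ℝ → ℝ}
    {N : ℕ} {x : ℝ} {k l : ℤ} (hk : -(N : ℤ) ≤ k) (hl : l ≤ N + 1)
    (h : ∀ i ∈ Finset.Icc (-(N : ℤ)) N, i ∉ Finset.Ico k l →
      piTerm b α f ⌊x * (2 : ℝ) ^ i⌋ i x = 0) :
    dyadicPartialSum (piTerm b α f) N x =
      ∑ i ∈ Finset.Ico k l, piTerm b α f ⌊x * (2 : ℝ) ^ i⌋ i x := by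
  rw [dyadicPartialSum_piTerm]
  refine (Finset.sum_subset (fun i hi => ?_) h).symm
  simp only [Finset.mem_Ico, Finset.mem_Icc] at hi ⊢
  lia

lemma mem_parent {n k : ℤ} {x : ℝ} : x ∈ dyadicI n (k - 1) ↔ ⌊x * (2 : ℝ) ^ k⌋ / 2 = n := by
  rw [mem_dyadicI_iff, floor_mul_two_zpow_eq_ediv, sub_add_cancel]

lemma oscillation_le_of_sigmaV_eq_zero {m : ℕ} (hm : 1 ≤ m) {α : Fin m → Bool}
    (hα : sigmaV α = 0) {p : Fin m → ℝ} (hp : ∀ j, 1 < p j) {r : ℝ} (hr1 : 1 < r)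
    (hr : ∑ j, 1 / p j = 1 / r) {b : ℝ → ℝ} (hb : LocallyIntegrable b volume) {C : ℝ}
    (h : ∀ (f : Fin m → ℝ → ℝ) (g : ℝ → ℝ), (∀ j, BCS (f j)) →
      HasDyadicSum (piTerm b α f) g → eLpNorm' g r volume ≤
        ENNReal.ofReal C * ∏ j, eLpNorm (f j) (ENNReal.ofReal (p j)) volume) (n k : ℤ) :
    ENNReal.ofReal ((2 : ℝ) ^ k) * ∫⁻ x in dyadicI n k, ENNReal.ofReal |b x - avgI b n k| ≤
      ENNReal.ofReal (2 ^ (m + 1) * C) := by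
  have hα' : ∀ j, α j = true := by
    intro j
    have := Finset.filter_eq_empty_iff.1 (Finset.card_eq_zero.1 hα) (Finset.mem_univ j)
    simpa using this
  -- The test function is `1` on `I`, `-1` on the dyadic sibling of `I`, and `0` elsewhere.
  let φ : ℤ → ℝ := fun i => (if i = n then 1 else 0) - if i = 4 * (n / 2) + 1 - n then 1 else 0
  let f : ℝ → ℝ := fun x => φ ⌊x * (2 : ℝ) ^ k⌋
  have hstep : IsDyadicStep k f := isDyadicStep_comp φ k
  have hbd : ∀ x, |f x| ≤ 2 := by
    intro x
    simp only [f, φ]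
    split_ifs <;> norm_num
  have hsupp : ∀ x ∉ dyadicI (n / 2) (k - 1), f x = 0 := by
    intro x hx
    rw [mem_parent] at hx
    simp only [f, φ]
    rw [if_neg (by rintro h; exact hx (by rw [h])), if_neg (by lia), sub_zero]
  have hf := hstep.locallyIntegrable hbd
  have havg : ∀ i, avgI f i k = φ i := fun i =>
    avgI_eq_of_eqOn fun x hx => by simp only [f, mem_dyadicI_iff.1 hx]
  have hzero : ∀ l < k, ∀ i, avgI f i l = 0 := by
    intro l hl i
    refine avgI_eq_zero_of_le hf (k := k - 1) (fun i => ?_) (by lia) i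
    rw [avgI_eq_half_add hf, sub_add_cancel, havg, havg]
    simp only [φ]
    split_ifs <;> first | (exfalso; lia) | norm_num
  have hterm : ∀ l x, piTerm b α (fun _ => f) ⌊x * (2 : ℝ) ^ l⌋ l x =
      dyadicExp f l x ^ m * (dyadicExp b (l + 1) x - dyadicExp b l x) := by
    intro l x
    rw [piTerm, hα, ← pairH_mul_haarF hb (mem_dyadicI_iff.2 rfl), dyadicExp]
    simp only [coefI, hα', if_true, Finset.prod_const, Finset.card_univ, Fintype.card_fin]
    ring
  let g : ℝ → ℝ := fun x => f x ^ m * (b x - dyadicExp b k x)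
  have hsum : HasDyadicSum (piTerm b α fun _ => f) g := by
    filter_upwards [ae_tendsto_dyadicExp hb] with x hx
    have hlim : Tendsto (fun N : ℕ => (N : ℤ) + 1) atTop atTop :=
      tendsto_atTop_add_const_right _ _ tendsto_natCast_atTop_atTop
    refine (((hx.comp hlim).sub_const (dyadicExp b k x)).const_mul (f x ^ m)).congr' ?_
    filter_upwards [eventually_ge_atTop k.natAbs] with N hN
    obtain ⟨d, hd⟩ := Int.le.dest (by lia : k ≤ (N : ℤ) + 1)
    rw [dyadicPartialSum_eq_sum_Ico (k := k) (l := k + d) (by lia) (by lia)]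
    · simp only [Function.comp]
      rw [← hd, ← sum_Ico_int_sub (fun l => dyadicExp b l x), Finset.mul_sum]
      refine Finset.sum_congr rfl fun l hl => ?_
      rw [hterm, hstep.dyadicExp_eq (Finset.mem_Ico.1 hl).1]
    · intro l hl hl'
      simp only [Finset.mem_Icc, Finset.mem_Ico] at hl hl'
      rw [hterm, dyadicExp, hzero l (by lia), zero_pow (by lia), zero_mul]
  have hg : AEStronglyMeasurable g volume :=
    (hstep.measurable.pow_const m).aestronglyMeasurable.mul (hb.aestronglyMeasurable.sub
      (isDyadicStep_dyadicExp b k).measurable.aestronglyMeasurable)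
  have hfinal := lintegral_le_of_eLpNorm_le hp hr1 hr (n := n) (k := k) (fun _ => hbd)
    (fun _ => hsupp) hg (h _ g (fun _ => hstep.bcs hbd hsupp) hsum)
  refine le_trans (le_of_eq ?_) hfinal
  congr 1
  refine setLIntegral_congr_fun (measurableSet_dyadicI n k) fun x hx => ?_
  have hfx : f x = 1 := by
    simp only [f, φ, mem_dyadicI_iff.1 hx]
    rw [if_pos trivial, if_neg (by lia), sub_zero]
  simp only [g, hfx, one_pow, one_mul, dyadicExp_eq hx]

lemma abs_avgI_le {u : ℝ → ℝ} {M : ℝ} (hu : ∀ x, |u x| ≤ M) (n k : ℤ) : |avgI u n k| ≤ M := by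
  have h := norm_setIntegral_le_of_norm_le_const (f := u) (C := M)
    (volume_dyadicI_ne_top n k).lt_top (fun x _ => hu x)
  rw [Real.norm_eq_abs, volume_real_dyadicI] at h
  have hk : (0 : ℝ) < (2 : ℝ) ^ k := by positivity
  rw [avgI, abs_mul, abs_of_pos hk]
  calc (2 : ℝ) ^ k * |∫ x in dyadicI n k, u x| ≤ (2 : ℝ) ^ k * (M * (2 : ℝ) ^ (-k)) := by gcongr
    _ = M := by
      rw [zpow_neg]
      field_simp

lemma setIntegral_eq_avgI (u : ℝ → ℝ) (n k : ℤ) :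
    ∫ x in dyadicI n k, u x = (2 : ℝ) ^ (-k) * avgI u n k := by
  rw [avgI, ← mul_assoc, ← zpow_add₀ two_ne_zero]
  simp

lemma setIntegral_dyadicExp {u : ℝ → ℝ} (hu : LocallyIntegrable u volume) (d : ℕ) (n k : ℤ) :
    ∫ x in dyadicI n k, dyadicExp u (k + d) x = ∫ x in dyadicI n k, u x := by
  induction d generalizing n k with
  | zero =>
    rw [setIntegral_eq_avgI u, setIntegral_dyadicI_of_eqOn fun x hx => ?_]
    simpa using dyadicExp_eq hx
  | succ d ih =>
    rw [setIntegral_dyadicI_eq_add ((isDyadicStep_dyadicExp u _).integrableOn (by lia) n),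
      setIntegral_dyadicI_eq_add (integrableOn_dyadicI hu n k),
      show k + ((d + 1 : ℕ) : ℤ) = k + 1 + d by push_cast; ring, ih, ih]

lemma subset_parent (n k : ℤ) : dyadicI n k ⊆ dyadicI (n / 2) (k - 1) := by
  intro x hx
  rw [mem_parent, mem_dyadicI_iff.1 hx]

lemma oscillation_dyadicExp_le_of_sigmaV_eq_one {m : ℕ} {α : Fin m → Bool}
    (hα : sigmaV α = 1) {p : Fin m → ℝ} (hp : ∀ j, 1 < p j) {r : ℝ} (hr1 : 1 < r)
    (hr : ∑ j, 1 / p j = 1 / r) {b : ℝ → ℝ} (hb : LocallyIntegrable b volume) {C : ℝ}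
    (h : ∀ (f : Fin m → ℝ → ℝ) (g : ℝ → ℝ), (∀ j, BCS (f j)) →
      HasDyadicSum (piTerm b α f) g → eLpNorm' g r volume ≤
        ENNReal.ofReal C * ∏ j, eLpNorm (f j) (ENNReal.ofReal (p j)) volume)
    (n k : ℤ) (d : ℕ) :
    ENNReal.ofReal ((2 : ℝ) ^ k) *
        ∫⁻ x in dyadicI n k, ENNReal.ofReal |dyadicExp b (k + d) x - avgI b n k| ≤
      ENNReal.ofReal (2 ^ (m + 1) * C) := by
  obtain ⟨i₀, hi₀⟩ := Finset.card_eq_one.1 hα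
  have hα' : ∀ j, α j = false ↔ j = i₀ := by
    intro j
    have := Finset.ext_iff.1 hi₀ j
    simpa using this
  have hkd : k ≤ k + (d : ℤ) := by lia
  let B := avgI b n k
  let s : ℝ → ℝ := fun x => if 0 ≤ dyadicExp b (k + d) x - B then 1 else -1
  have hs_step : IsDyadicStep (k + d) s := by
    intro x y hxy
    simp only [s, isDyadicStep_dyadicExp b (k + d) x y hxy]
  have hs_bd : ∀ x, |s x| ≤ 1 := by
    intro x
    simp only [s]
    split_ifs <;> norm_num
  let c := avgI s n k
  -- The test functions: a centred sign function in the cancellative slot, `1_I` in the others.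
  let φ : ℝ → ℝ := (dyadicI n k).indicator fun x => s x - c
  let ψ : ℝ → ℝ := (dyadicI n k).indicator fun _ => 1
  let f : Fin m → ℝ → ℝ := fun j => if j = i₀ then φ else ψ
  have hφ_step : IsDyadicStep (k + d) φ :=
    isDyadicStep_indicator n hkd fun x y hxy => by simp only [hs_step x y hxy]
  have hψ_step : IsDyadicStep k ψ := isDyadicStep_indicator_one n k
  have hφ_bd : ∀ x, |φ x| ≤ 2 := by
    intro x
    simp only [φ, Set.indicator_apply]
    split_ifs
    · have h1 := abs_le.1 (hs_bd x)
      have h2 := abs_le.1 (abs_avgI_le hs_bd n k)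
      exact abs_le.2 ⟨by linarith [h1.1, h2.2], by linarith [h1.2, h2.1]⟩
    · norm_num
  have hφ_zero : ∀ x ∉ dyadicI n k, φ x = 0 := fun x hx => Set.indicator_of_notMem hx _
  have hf_step : ∀ j, IsDyadicStep (k + d) (f j) := by
    intro j
    simp only [f]
    split_ifs
    exacts [hφ_step, hψ_step.mono hkd]
  have hf_bd : ∀ j x, |f j x| ≤ 2 := by
    intro j x
    simp only [f]
    split_ifs
    · exact hφ_bd x
    · simp only [ψ, Set.indicator_apply]
      split_ifs <;> norm_num
  have hf_supp : ∀ j, ∀ x ∉ dyadicI (n / 2) (k - 1), f j x = 0 := by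
    intro j x hx
    have hx' : x ∉ dyadicI n k := fun h' => hx (subset_parent n k h')
    simp only [f]
    split_ifs
    exacts [hφ_zero x hx', Set.indicator_of_notMem hx' _]
  have hφ := hφ_step.locallyIntegrable hφ_bd
  have hφ_int : ∫ x in dyadicI n k, φ x = 0 := by
    rw [setIntegral_congr_fun (measurableSet_dyadicI n k)
      (fun x hx => Set.indicator_of_mem hx _), integral_sub (hs_step.integrableOn hkd n)
      (integrableOn_const (volume_dyadicI_ne_top n k)), setIntegral_eq_avgI s,
      setIntegral_dyadicI_of_eqOn fun _ _ => rfl, sub_self]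
  have hφ_avg : ∀ i, avgI φ i k = 0 := by
    intro i
    by_cases hi : i = n
    · rw [hi, avgI, hφ_int, mul_zero]
    · refine avgI_eq_of_eqOn fun x hx => hφ_zero x fun hx' => hi ?_
      rw [← mem_dyadicI_iff.1 hx, mem_dyadicI_iff.1 hx']
  have hφ_out : ∀ l, k ≤ l → ∀ x ∉ dyadicI n k, dyadicExp φ l x = 0 := by
    intro l hl x hx
    refine avgI_eq_of_eqOn fun y hy => hφ_zero y fun hy' => ?_
    have := hψ_step.mono hl y x (mem_dyadicI_iff.1 hy)
    simp [ψ, hx, hy'] at this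
  have hterm : ∀ l x, piTerm b α f ⌊x * (2 : ℝ) ^ l⌋ l x =
      diffMul b φ l x * dyadicExp ψ l x ^ (m - 1) := by
    intro l x
    have hprod : ∏ j, coefI (f j) (α j) ⌊x * (2 : ℝ) ^ l⌋ l =
        pairH φ ⌊x * (2 : ℝ) ^ l⌋ l * dyadicExp ψ l x ^ (m - 1) := by
      rw [← Finset.mul_prod_erase _ _ (Finset.mem_univ i₀)]
      congr 1
      · simp [coefI, f, (hα' i₀).2 rfl]
      · rw [Finset.prod_congr rfl (g := fun _ => dyadicExp ψ l x)]
        · simp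
        · intro j hj
          have hj' : j ≠ i₀ := Finset.ne_of_mem_erase hj
          have hαj : α j = true := by simpa [hj'] using hα' j
          simp [coefI, f, hj', hαj, dyadicExp]
    rw [piTerm, hα, hprod, diffMul, ← pairH_mul_haarF hb (mem_dyadicI_iff.2 rfl),
      ← pairH_mul_haarF hφ (mem_dyadicI_iff.2 rfl)]
    ring
  let g : ℝ → ℝ := fun x => ∑ l ∈ Finset.Ico k (k + d), diffMul b φ l x
  have hg_step : IsDyadicStep (k + d) g := isDyadicStep_sum_diffMul b φ k (k + d)
  have hsum : HasDyadicSum (piTerm b α f) g := by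
    refine Eventually.of_forall fun x => tendsto_const_nhds.congr' ?_
    filter_upwards [eventually_ge_atTop (k.natAbs + d)] with N hN
    rw [dyadicPartialSum_eq_sum_Ico (k := k) (l := k + d) (by lia) (by lia)]
    · refine Finset.sum_congr rfl fun l hl => ?_
      have hl := (Finset.mem_Ico.1 hl).1
      rw [hterm, hψ_step.dyadicExp_eq hl]
      by_cases hx : x ∈ dyadicI n k
      · simp [ψ, hx]
      · simp [diffMul, hφ_out l hl x hx, hφ_out (l + 1) (by lia) x hx]
    · intro l _ hl
      rw [hterm, diffMul]
      rcases lt_or_ge l k with hlk | hlk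
      · rw [dyadicExp, dyadicExp, dyadicExp, dyadicExp, avgI_eq_zero_of_le hφ hφ_avg (by lia),
          avgI_eq_zero_of_le hφ hφ_avg (by lia)]
        ring
      · have hl' : k + d ≤ l := by
          simp only [Finset.mem_Ico] at hl
          lia
        rw [hφ_step.dyadicExp_eq hl', hφ_step.dyadicExp_eq (by lia : k + d ≤ l + 1)]
        ring
  have hbound := lintegral_le_of_eLpNorm_le hp hr1 hr (n := n) (k := k) hf_bd hf_supp
    hg_step.measurable.aestronglyMeasurable
    (h f g (fun j => (hf_step j).bcs (hf_bd j) (hf_supp j)) hsum)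
  refine le_trans (mul_le_mul' le_rfl ?_) hbound
  have hE := (isDyadicStep_dyadicExp b (k + d)).integrableOn hkd n
  have hB : IntegrableOn (fun _ => B) (dyadicI n k) :=
    integrableOn_const (volume_dyadicI_ne_top n k)
  have hEB : ∫ x in dyadicI n k, (dyadicExp b (k + d) x - B) = 0 := by
    rw [integral_sub hE hB, setIntegral_dyadicExp hb, setIntegral_eq_avgI b,
      setIntegral_dyadicI_of_eqOn fun _ _ => rfl, sub_self]
  have hint : ∫ x in dyadicI n k, g x = ∫ x in dyadicI n k, |dyadicExp b (k + d) x - B| := by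
    have hpt : ∀ x ∈ dyadicI n k, dyadicExp b (k + d) x * dyadicExp φ (k + d) x =
        |dyadicExp b (k + d) x - B| - c * (dyadicExp b (k + d) x - B) + B * φ x := by
      intro x hx
      have hφx : φ x = s x - c := Set.indicator_of_mem hx _
      have hsx : s x * (dyadicExp b (k + d) x - B) = |dyadicExp b (k + d) x - B| := by
        simp only [s]
        split_ifs with h0
        · rw [one_mul, abs_of_nonneg h0]
        · rw [abs_of_neg (not_le.1 h0), neg_one_mul]
      rw [hφ_step.dyadicExp_eq le_rfl, hφx, ← hsx]
      ring
    rw [setIntegral_sum_diffMul hb hφ, hφ_avg,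
      setIntegral_congr_fun (measurableSet_dyadicI n k) hpt, integral_add, integral_sub,
      integral_const_mul, integral_const_mul, hEB, hφ_int]
    · ring
    · exact (hE.sub hB).abs
    · exact (hE.sub hB).const_mul c
    · exact (hE.sub hB).abs.sub ((hE.sub hB).const_mul c)
    · exact (hφ_step.integrableOn hkd n).const_mul B
  have hg_int := hg_step.integrableOn hkd n
  have habs : IntegrableOn (fun x => |dyadicExp b (k + d) x - B|) (dyadicI n k) :=
    (hE.sub hB).abs
  rw [← ofReal_integral_eq_lintegral_ofReal habs
      (Eventually.of_forall fun _ => abs_nonneg _),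
    ← ofReal_integral_eq_lintegral_ofReal hg_int.abs
      (Eventually.of_forall fun _ => abs_nonneg _)]
  refine ENNReal.ofReal_le_ofReal (hint.symm.le.trans ?_)
  exact integral_mono hg_int hg_int.abs fun x => le_abs_self _

lemma oscillation_le_of_dyadicExp {b : ℝ → ℝ} (hb : LocallyIntegrable b volume) {n k : ℤ}
    {c : ℝ} {A R : ℝ≥0∞} (hA : A ≠ ∞)
    (h : ∀ d : ℕ, A * ∫⁻ x in dyadicI n k, ENNReal.ofReal |dyadicExp b (k + d) x - c| ≤ R) :
    A * ∫⁻ x in dyadicI n k, ENNReal.ofReal |b x - c| ≤ R := by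
  rw [← lintegral_const_mul' _ _ hA]
  have hlim : ∀ᵐ x ∂volume.restrict (dyadicI n k), A * ENNReal.ofReal |b x - c| =
      liminf (fun d : ℕ => A * ENNReal.ofReal |dyadicExp b (k + d) x - c|) atTop := by
    filter_upwards [ae_restrict_of_ae (ae_tendsto_dyadicExp hb)] with x hx
    have hd : Tendsto (fun d : ℕ => k + (d : ℤ)) atTop atTop :=
      tendsto_atTop_add_const_left _ _ tendsto_natCast_atTop_atTop
    have h1 := ENNReal.tendsto_ofReal (((hx.comp hd).sub_const c).abs)
    exact (ENNReal.Tendsto.const_mul h1 (Or.inr hA)).liminf_eq.symm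
  rw [lintegral_congr_ae hlim]
  refine (lintegral_liminf_le fun d => ?_).trans
    (liminf_le_of_frequently_le' (Frequently.of_forall fun d => ?_))
  · have hmeas := (isDyadicStep_dyadicExp b (k + d)).measurable
    exact (((hmeas.sub_const c).abs).ennreal_ofReal).const_mul A
  · rw [lintegral_const_mul' _ _ hA]
    exact h d

/-- For `m ≥ 1`, `σ(α⃗) ≤ 1`, `1 < p_j, r < ∞` with `Σ_j 1/p_j = 1/r`:
if `‖π_b^{α⃗}(f₁,…,f_m)‖_{L^r} ≤ C ∏_j ‖f_j‖_{L^{p_j}}` for all bounded compactly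
supported `f_j`, then `b ∈ BMO^d` with `‖b‖_{BMO^d} ≤ C'·C`, `C' = C'(m, p⃗, r)`. -/
theorem statement5 (m : ℕ) (hm : 1 ≤ m) (α : Fin m → Bool) (hα : sigmaV α ≤ 1)
    (p : Fin m → ℝ) (hp : ∀ j, 1 < p j) (r : ℝ) (hr1 : 1 < r)
    (hr : ∑ j, 1 / p j = 1 / r) :
    ∃ C' : ℝ, 0 < C' ∧ ∀ b : ℝ → ℝ, LocallyIntegrable b volume → ∀ C : ℝ,
      (∀ (f : Fin m → ℝ → ℝ) (g : ℝ → ℝ), (∀ j, BCS (f j)) →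
        HasDyadicSum (piTerm b α f) g →
        eLpNorm' g r volume ≤
          ENNReal.ofReal C * ∏ j, eLpNorm (f j) (ENNReal.ofReal (p j)) volume) →
      bmoNorm b < ⊤ ∧ bmoNorm b ≤ ENNReal.ofReal (C' * C) := by
  refine ⟨2 ^ (m + 1), by positivity, fun b hb C h => ?_⟩
  suffices hbmo : bmoNorm b ≤ ENNReal.ofReal (2 ^ (m + 1) * C) from
    ⟨hbmo.trans_lt ENNReal.ofReal_lt_top, hbmo⟩
  refine iSup₂_le fun n k => ?_
  rcases Nat.le_one_iff_eq_zero_or_eq_one.1 hα with hσ | hσ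
  · exact oscillation_le_of_sigmaV_eq_zero hm hσ hp hr1 hr hb h n k
  · exact oscillation_le_of_dyadicExp hb ENNReal.ofReal_ne_top
      (oscillation_dyadicExp_le_of_sigmaV_eq_one hσ hp hr1 hr hb h n k)

end
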